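/- Every h-convex body K in ℍ^{n+1} is the intersection of all its supporting horo-balls: K = ∩_{e ∈ 𝕊^n} B̄_e(u(K,e)). -/

import Mathlib

noncomputable section

open Real MeasureTheory Filter Topology Set
open scoped ENNReal symmDiff

namespace Horo

/-- The Lorentzian inner product on ℝ^{n+2}:
`X·Y = Σ_{i=1}^{n+1} x_i y_i − x_{n+2} y_{n+2}`. -/
def lprod (n : ℕ) (X Y : Fin (n + 2) → ℝ) : ℝ :=
  (∑ i : Fin (n + 1), X i.castSucc * Y i.castSucc) - X (Fin.last (n + 1)) * Y (Fin.last (n + 1))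

/-- The hyperboloid model ℍ^{n+1} of hyperbolic space. -/
def Hyp (n : ℕ) : Set (Fin (n + 2) → ℝ) :=
  {X | lprod n X X = -1 ∧ 0 < X (Fin.last (n + 1))}

/-- The origin O = (0,…,0,1) of hyperbolic space. -/
def origin (n : ℕ) : Fin (n + 2) → ℝ := Fin.snoc (fun _ => 0) 1

/-- The unit sphere 𝕊^n ⊂ ℝ^{n+1}. -/
def sph (n : ℕ) : Set (Fin (n + 1) → ℝ) := {e | ∑ i, e i ^ 2 = 1}

/-- The null vector (e,1) ∈ ℝ^{n+2} associated with e ∈ 𝕊^n. -/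
def dir {n : ℕ} (e : Fin (n + 1) → ℝ) : Fin (n + 2) → ℝ := Fin.snoc e 1

/-- The geodesic distance d(X,Y) = arcosh(−X·Y) on the hyperboloid. -/
def dH (n : ℕ) (X Y : Fin (n + 2) → ℝ) : ℝ :=
  Real.log (-(lprod n X Y) + Real.sqrt ((lprod n X Y) ^ 2 - 1))

/-- The horosphere H_e(s) = {X ∈ ℍ^{n+1} : X·(e,1) = −e^s}. -/
def horoSphere (n : ℕ) (e : Fin (n + 1) → ℝ) (s : ℝ) : Set (Fin (n + 2) → ℝ) :=
  {X ∈ Hyp n | lprod n X (dir e) = -Real.exp s}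

/-- The open horo-ball B_e(s) = {X ∈ ℍ^{n+1} : 0 > X·(e,1) > −e^s}. -/
def horoBall (n : ℕ) (e : Fin (n + 1) → ℝ) (s : ℝ) : Set (Fin (n + 2) → ℝ) :=
  {X ∈ Hyp n | 0 > lprod n X (dir e) ∧ lprod n X (dir e) > -Real.exp s}

/-- The closed horo-ball B̄_e(s) = {X ∈ ℍ^{n+1} : 0 > X·(e,1) ≥ −e^s}. -/
def horoBallCl (n : ℕ) (e : Fin (n + 1) → ℝ) (s : ℝ) : Set (Fin (n + 2) → ℝ) :=
  {X ∈ Hyp n | 0 > lprod n X (dir e) ∧ lprod n X (dir e) ≥ -Real.exp s}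

/-- A set Ω ⊂ ℍ^{n+1} is horospherically convex (h-convex) if it is closed and every
relative boundary point of Ω admits a supporting horo-ball. -/
def IsHConvex (n : ℕ) (Ω : Set (Fin (n + 2) → ℝ)) : Prop :=
  Ω ⊆ Hyp n ∧ IsClosed Ω ∧
    ∀ X ∈ Ω ∩ closure (Hyp n \ Ω),
      ∃ e ∈ sph n, ∃ s : ℝ, Ω ⊆ horoBallCl n e s ∧ X ∈ horoSphere n e s

/-- The interior of a subset of the hyperboloid, relative to the hyperboloid. -/
def relInt (n : ℕ) (K : Set (Fin (n + 2) → ℝ)) : Set (Fin (n + 2) → ℝ) :=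
  {X ∈ Hyp n | ∃ ε > 0, ∀ Y ∈ Hyp n, dH n X Y < ε → Y ∈ K}

/-- A h-convex body: a compact h-convex set with nonempty (relative) interior. -/
def IsHConvexBody (n : ℕ) (K : Set (Fin (n + 2) → ℝ)) : Prop :=
  IsHConvex n K ∧ IsCompact K ∧ (relInt n K).Nonempty

/-- A h-convex polytope: a h-convex body which is a finite intersection of closed
horo-balls. -/
def IsHPolytope (n : ℕ) (P : Set (Fin (n + 2) → ℝ)) : Prop :=
  IsHConvexBody n P ∧ ∃ m : ℕ, 2 ≤ m ∧ ∃ (e : Fin m → (Fin (n + 1) → ℝ)) (u : Fin m → ℝ),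
    (∀ i, e i ∈ sph n) ∧ P = ⋂ i, horoBallCl n (e i) (u i)

/-- The horospherical support function u(K,e) = sup{log(−X·(e,1)) : X ∈ K}. -/
def suppFn (n : ℕ) (K : Set (Fin (n + 2) → ℝ)) (e : Fin (n + 1) → ℝ) : ℝ :=
  sSup ((fun X => Real.log (-(lprod n X (dir e)))) '' K)

/-- The outer parallel set K^ε = {X ∈ ℍ^{n+1} : d(K,X) ≤ ε}. -/
def outPar (n : ℕ) (K : Set (Fin (n + 2) → ℝ)) (ε : ℝ) : Set (Fin (n + 2) → ℝ) :=
  {X ∈ Hyp n | ∃ Y ∈ K, dH n Y X ≤ ε}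

/-- The Hausdorff distance d_H(K,L) = inf{ε ≥ 0 : K ⊆ L^ε and L ⊆ K^ε}. -/
def dHaus (n : ℕ) (K L : Set (Fin (n + 2) → ℝ)) : ℝ :=
  sInf {ε : ℝ | 0 ≤ ε ∧ K ⊆ outPar n L ε ∧ L ⊆ outPar n K ε}

/-- The point (sinh r · θ, cosh r) ∈ ℍ^{n+1} at distance r from O in direction θ. -/
def rpt (n : ℕ) (θ : Fin (n + 1) → ℝ) (r : ℝ) : Fin (n + 2) → ℝ :=
  Fin.snoc (fun i => Real.sinh r * θ i) (Real.cosh r)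

/-- The radial function ρ(K,θ) = max{λ ≥ 0 : (sinh λ · θ, cosh λ) ∈ K}. -/
def radFn (n : ℕ) (K : Set (Fin (n + 2) → ℝ)) (θ : Fin (n + 1) → ℝ) : ℝ :=
  sSup {r : ℝ | 0 ≤ r ∧ rpt n θ r ∈ K}

/-- R(K) = max_θ ρ(K,θ). -/
def Rmax (n : ℕ) (K : Set (Fin (n + 2) → ℝ)) : ℝ := sSup (radFn n K '' sph n)

/-- r(K) = min_θ ρ(K,θ). -/
def rmin (n : ℕ) (K : Set (Fin (n + 2) → ℝ)) : ℝ := sInf (radFn n K '' sph n)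

/-- The point reflection (x_1,…,x_{n+1},x_{n+2}) ↦ (−x_1,…,−x_{n+1},x_{n+2}) about O. -/
def symMap (n : ℕ) (X : Fin (n + 2) → ℝ) : Fin (n + 2) → ℝ :=
  fun i => if i = Fin.last (n + 1) then X i else -X i

/-- The hyperbolic (Riemannian) volume of a subset of the hyperboloid, computed via the
graph parametrization x ↦ (x, √(1+|x|²)), whose volume density is 1/√(1+|x|²). -/
def hypVol (n : ℕ) (K : Set (Fin (n + 2) → ℝ)) : ℝ :=
  ∫ x : Fin (n + 1) → ℝ,
    Set.indicator {y : Fin (n + 1) → ℝ | Fin.snoc y (Real.sqrt (1 + ∑ i, y i ^ 2)) ∈ K}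
      (fun y => 1 / Real.sqrt (1 + ∑ i, y i ^ 2)) x

/-- The distance from a point X to a set P. -/
def distTo (n : ℕ) (P : Set (Fin (n + 2) → ℝ)) (X : Fin (n + 2) → ℝ) : ℝ :=
  sInf ((fun Y => dH n Y X) '' P)

/-- The facet F(P,e) = P ∩ H_e(u(P,e)). -/
def facet (n : ℕ) (P : Set (Fin (n + 2) → ℝ)) (e : Fin (n + 1) → ℝ) :
    Set (Fin (n + 2) → ℝ) :=
  P ∩ horoSphere n e (suppFn n P e)

/-- The relative interior of the facet F(P,e) inside the horosphere H_e(u(P,e)). -/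
def facetRelInt (n : ℕ) (P : Set (Fin (n + 2) → ℝ)) (e : Fin (n + 1) → ℝ) :
    Set (Fin (n + 2) → ℝ) :=
  {Y ∈ facet n P e | ∃ δ > 0, ∀ Z ∈ horoSphere n e (suppFn n P e),
    dH n Y Z < δ → Z ∈ facet n P e}

/-- The collar 𝒫_t(P, F̊(P,e)): points at positive distance ≤ t from P whose nearest
point in P lies in the relative interior of the facet F(P,e). -/
def collar (n : ℕ) (P : Set (Fin (n + 2) → ℝ)) (e : Fin (n + 1) → ℝ) (t : ℝ) :
    Set (Fin (n + 2) → ℝ) :=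
  {X ∈ Hyp n | 0 < distTo n P X ∧ distTo n P X ≤ t ∧
    ∃ Y ∈ facetRelInt n P e, ∀ Z ∈ P, dH n Y X ≤ dH n Z X}

/-- The diameter of a set with respect to a distance function, in ℝ≥0∞. -/
def ediamWith {α : Type*} (d : α → α → ℝ) (U : Set α) : ℝ≥0∞ :=
  ⨆ (x ∈ U) (y ∈ U), ENNReal.ofReal (d x y)

/-- The (unnormalized) s-dimensional Hausdorff measure associated with a distance
function d, via the Carathéodory construction. -/
def hMeasWith {α : Type*} (d : α → α → ℝ) (s : ℕ) (A : Set α) : ℝ≥0∞ :=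
  ⨆ (δ : ℝ) (_ : 0 < δ),
    ⨅ (U : ℕ → Set α) (_ : A ⊆ ⋃ i, U i) (_ : ∀ i, ediamWith d (U i) ≤ ENNReal.ofReal δ),
      ∑' i, ediamWith d (U i) ^ s

/-- ω_n, the volume of the unit ball in ℝ^n. -/
def unitBallVol (n : ℕ) : ℝ :=
  (volume (Metric.ball (0 : EuclideanSpace ℝ (Fin n)) 1)).toReal

/-- S(P,e): the n-dimensional area of the facet F(P,e), i.e. the normalized
n-dimensional Hausdorff measure of F(P,e) with respect to the hyperbolic distance. -/
def areaFacet (n : ℕ) (P : Set (Fin (n + 2) → ℝ)) (e : Fin (n + 1) → ℝ) : ℝ :=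
  (ENNReal.ofReal (unitBallVol n / 2 ^ n) * hMeasWith (dH n) n (facet n P e)).toReal


theorem lprod_comm (n : ℕ) (X Y : Fin (n + 2) → ℝ) : lprod n X Y = lprod n Y X := by
  simp only [lprod, mul_comm]

theorem lprod_add_left (n : ℕ) (X Y Z : Fin (n + 2) → ℝ) :
    lprod n (X + Y) Z = lprod n X Z + lprod n Y Z := by
  simp only [lprod, Pi.add_apply, add_mul, Finset.sum_add_distrib]
  ring

theorem lprod_smul_left (n : ℕ) (a : ℝ) (X Z : Fin (n + 2) → ℝ) :
    lprod n (a • X) Z = a * lprod n X Z := by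
  simp only [lprod, Pi.smul_apply, smul_eq_mul, mul_sub, Finset.mul_sum, mul_assoc]

theorem lprod_dir (n : ℕ) (X : Fin (n + 2) → ℝ) (e : Fin (n + 1) → ℝ) :
    lprod n X (dir e) = (∑ i, X (Fin.castSucc i) * e i) - X (Fin.last (n + 1)) := by
  simp [lprod, dir]

theorem continuous_lprod_left (n : ℕ) (Z : Fin (n + 2) → ℝ) :
    Continuous fun X => lprod n X Z := by
  unfold lprod
  fun_prop

theorem sum_sq_eq_of_mem_Hyp {n : ℕ} {X : Fin (n + 2) → ℝ} (hX : X ∈ Hyp n) :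
    ∑ i : Fin (n + 1), X i.castSucc ^ 2 = X (Fin.last (n + 1)) ^ 2 - 1 := by
  have h := hX.1
  simp only [lprod, ← sq] at h
  linarith

theorem one_le_last_of_mem_Hyp {n : ℕ} {X : Fin (n + 2) → ℝ} (hX : X ∈ Hyp n) :
    1 ≤ X (Fin.last (n + 1)) := by
  have h := sum_sq_eq_of_mem_Hyp hX
  have h0 : 0 ≤ ∑ i : Fin (n + 1), X i.castSucc ^ 2 := Finset.sum_nonneg fun i _ => sq_nonneg _
  nlinarith [hX.2]

theorem lprod_dir_neg {n : ℕ} {X : Fin (n + 2) → ℝ} (hX : X ∈ Hyp n)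
    {e : Fin (n + 1) → ℝ} (he : e ∈ sph n) : lprod n X (dir e) < 0 := by
  rw [lprod_dir, sub_neg]
  refine lt_of_pow_lt_pow_left₀ 2 hX.2.le ?_
  have h := Finset.sum_mul_sq_le_sq_mul_sq Finset.univ (fun i : Fin (n + 1) => X i.castSucc) e
  rw [sum_sq_eq_of_mem_Hyp hX, show ∑ i, e i ^ 2 = 1 from he] at h
  linarith

/-- The reversed Cauchy–Schwarz inequality, with its equality case. -/
theorem lprod_lt_neg_one {n : ℕ} {X Y : Fin (n + 2) → ℝ} (hX : X ∈ Hyp n) (hY : Y ∈ Hyp n)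
    (hne : X ≠ Y) : lprod n X Y < -1 := by
  by_contra! h
  apply hne
  have hcs := Finset.sum_mul_sq_le_sq_mul_sq Finset.univ
    (fun i : Fin (n + 1) => X i.castSucc) (fun i => Y i.castSucc)
  rw [sum_sq_eq_of_mem_Hyp hX, sum_sq_eq_of_mem_Hyp hY] at hcs
  have hx := one_le_last_of_mem_Hyp hX
  have hy := one_le_last_of_mem_Hyp hY
  have hsum : ∑ i : Fin (n + 1), (X i.castSucc - Y i.castSucc) ^ 2
      = (X (Fin.last (n + 1)) ^ 2 - 1) + (Y (Fin.last (n + 1)) ^ 2 - 1)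
        - 2 * ∑ i : Fin (n + 1), X i.castSucc * Y i.castSucc := by
    rw [← sum_sq_eq_of_mem_Hyp hX, ← sum_sq_eq_of_mem_Hyp hY, Finset.mul_sum,
      ← Finset.sum_add_distrib, ← Finset.sum_sub_distrib]
    exact Finset.sum_congr rfl fun i _ => by ring
  unfold lprod at h
  set S := ∑ i : Fin (n + 1), X i.castSucc * Y i.castSucc
  set x := X (Fin.last (n + 1)) with hxdef
  set y := Y (Fin.last (n + 1)) with hydef
  have hxy : 0 ≤ x * y - 1 := by nlinarith
  have hsq : (x * y - 1) ^ 2 ≤ S ^ 2 := pow_le_pow_left₀ hxy (by linarith) 2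
  have hlast : x = y := by
    have : (x - y) ^ 2 = 0 := le_antisymm (by nlinarith) (sq_nonneg _)
    exact sub_eq_zero.mp (pow_eq_zero_iff two_ne_zero |>.mp this)
  have hzero : ∑ i : Fin (n + 1), (X i.castSucc - Y i.castSucc) ^ 2 = 0 := by
    refine le_antisymm ?_ (Finset.sum_nonneg fun i _ => sq_nonneg _)
    rw [hsum]
    nlinarith
  rw [Finset.sum_eq_zero_iff_of_nonneg fun i _ => sq_nonneg _] at hzero
  funext j
  refine Fin.lastCases hlast (fun i => ?_) j
  exact sub_eq_zero.mp (pow_eq_zero_iff two_ne_zero |>.mp (hzero i (Finset.mem_univ i)))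

/-- The point `(1 - t) Y + t X` of the chord from `Y` to `X`. -/
def chord {n : ℕ} (Y X : Fin (n + 2) → ℝ) (t : ℝ) : Fin (n + 2) → ℝ := (1 - t) • Y + t • X

/-- The Lorentzian length of `chord Y X t`. -/
def chordLen {n : ℕ} (Y X : Fin (n + 2) → ℝ) (t : ℝ) : ℝ :=
  √((1 - t) ^ 2 + t ^ 2 - 2 * t * (1 - t) * lprod n Y X)

/-- The radial projection of the chord from `Y` to `X` onto the hyperboloid. -/
def geod {n : ℕ} (Y X : Fin (n + 2) → ℝ) (t : ℝ) : Fin (n + 2) → ℝ :=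
  (chordLen Y X t)⁻¹ • chord Y X t

theorem lprod_chord_self {n : ℕ} {X Y : Fin (n + 2) → ℝ} (hX : X ∈ Hyp n) (hY : Y ∈ Hyp n)
    (t : ℝ) : lprod n (chord Y X t) (chord Y X t)
      = -((1 - t) ^ 2 + t ^ 2 - 2 * t * (1 - t) * lprod n Y X) := by
  have key (Z : Fin (n + 2) → ℝ) :
      lprod n (chord Y X t) Z = (1 - t) * lprod n Y Z + t * lprod n X Z := by
    rw [chord, lprod_add_left, lprod_smul_left, lprod_smul_left]
  rw [key, lprod_comm n Y, lprod_comm n X, key, key, hX.1, hY.1, lprod_comm n X Y]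
  ring

theorem one_lt_chordLen {n : ℕ} {X Y : Fin (n + 2) → ℝ} (hX : X ∈ Hyp n) (hY : Y ∈ Hyp n)
    (hne : Y ≠ X) {t : ℝ} (ht0 : 0 < t) (ht1 : t < 1) : 1 < chordLen Y X t := by
  have h := lprod_lt_neg_one hY hX hne
  rw [chordLen, Real.lt_sqrt zero_le_one]
  nlinarith [mul_pos (mul_pos ht0 (sub_pos.mpr ht1)) (show 0 < -1 - lprod n Y X by linarith)]

theorem chordLen_zero {n : ℕ} (Y X : Fin (n + 2) → ℝ) : chordLen Y X 0 = 1 := by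
  simp [chordLen]

theorem chordLen_one {n : ℕ} (Y X : Fin (n + 2) → ℝ) : chordLen Y X 1 = 1 := by
  simp [chordLen]

theorem geod_zero {n : ℕ} (Y X : Fin (n + 2) → ℝ) : geod Y X 0 = Y := by
  simp [geod, chordLen_zero, chord]

theorem geod_one {n : ℕ} (Y X : Fin (n + 2) → ℝ) : geod Y X 1 = X := by
  simp [geod, chordLen_one, chord]

theorem chordLen_pos {n : ℕ} {X Y : Fin (n + 2) → ℝ} (hX : X ∈ Hyp n) (hY : Y ∈ Hyp n)
    (hne : Y ≠ X) {t : ℝ} (ht : t ∈ Icc (0 : ℝ) 1) : 0 < chordLen Y X t := by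
  rcases ht.1.eq_or_lt with rfl | h0
  · simp [chordLen_zero]
  rcases ht.2.eq_or_lt with rfl | h1
  · simp [chordLen_one]
  exact zero_lt_one.trans (one_lt_chordLen hX hY hne h0 h1)

theorem geod_mem_Hyp {n : ℕ} {X Y : Fin (n + 2) → ℝ} (hX : X ∈ Hyp n) (hY : Y ∈ Hyp n)
    (hne : Y ≠ X) {t : ℝ} (ht : t ∈ Icc (0 : ℝ) 1) : geod Y X t ∈ Hyp n := by
  have hpos := chordLen_pos hX hY hne ht
  constructor
  · have hsq : chordLen Y X t ^ 2 = (1 - t) ^ 2 + t ^ 2 - 2 * t * (1 - t) * lprod n Y X :=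
      Real.sq_sqrt (Real.sqrt_pos.mp hpos).le
    rw [geod, lprod_smul_left, lprod_comm, lprod_smul_left, lprod_chord_self hX hY, ← hsq]
    field_simp
  · have h1 := one_le_last_of_mem_Hyp hX
    have h2 := one_le_last_of_mem_Hyp hY
    simp only [geod, chord, Pi.smul_apply, Pi.add_apply, smul_eq_mul]
    refine mul_pos (inv_pos.mpr hpos) ?_
    nlinarith [mul_nonneg (sub_nonneg.mpr ht.2) (sub_nonneg.mpr h2),
      mul_nonneg ht.1 (sub_nonneg.mpr h1)]

theorem continuousOn_geod {n : ℕ} {X Y : Fin (n + 2) → ℝ} (hX : X ∈ Hyp n) (hY : Y ∈ Hyp n)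
    (hne : Y ≠ X) : ContinuousOn (geod Y X) (Icc 0 1) := by
  have h1 : Continuous (chordLen Y X) := by unfold chordLen; fun_prop
  have h2 : Continuous (chord Y X) := by unfold chord; fun_prop
  exact (h1.continuousOn.inv₀ fun t ht => (chordLen_pos hX hY hne ht).ne').smul h2.continuousOn

/-- Horo-balls are strictly convex along geodesics. -/
theorem neg_exp_lt_lprod_geod {n : ℕ} {X Y : Fin (n + 2) → ℝ} {e : Fin (n + 1) → ℝ} {s : ℝ}
    (hX : X ∈ horoBallCl n e s) (hY : Y ∈ horoBallCl n e s) (hne : Y ≠ X) {t : ℝ}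
    (ht0 : 0 < t) (ht1 : t < 1) : -Real.exp s < lprod n (geod Y X t) (dir e) := by
  have hlen := one_lt_chordLen hX.1 hY.1 hne ht0 ht1
  rw [geod, chord, lprod_smul_left, lprod_add_left, lprod_smul_left, lprod_smul_left,
    inv_mul_eq_div, lt_div_iff₀ (zero_lt_one.trans hlen)]
  have h1 := mul_le_mul_of_nonneg_left hX.2.2 ht0.le
  have h2 := mul_le_mul_of_nonneg_left hY.2.2 (sub_nonneg.mpr ht1.le)
  nlinarith [mul_pos (sub_pos.mpr hlen) (Real.exp_pos s)]

theorem dH_self {n : ℕ} {X : Fin (n + 2) → ℝ} (hX : X ∈ Hyp n) : dH n X X = 0 := by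
  simp [dH, hX.1]

theorem continuousAt_dH_self {n : ℕ} {X : Fin (n + 2) → ℝ} (hX : X ∈ Hyp n) :
    ContinuousAt (dH n X) X := by
  have h : Continuous fun Y => lprod n X Y := by
    simpa only [lprod_comm n X] using continuous_lprod_left n X
  unfold dH
  refine ContinuousAt.log (by fun_prop) ?_
  simp [hX.1]

theorem relInt_subset (n : ℕ) (K : Set (Fin (n + 2) → ℝ)) : relInt n K ⊆ K := by
  rintro X ⟨hX, ε, hε, h⟩
  exact h X hX (by rwa [dH_self hX])

theorem notMem_closure_of_mem_relInt {n : ℕ} {K : Set (Fin (n + 2) → ℝ)}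
    {X : Fin (n + 2) → ℝ} (hX : X ∈ relInt n K) : X ∉ closure (Hyp n \ K) := by
  obtain ⟨hX, ε, hε, h⟩ := hX
  have hev : ∀ᶠ Y in 𝓝 X, dH n X Y < ε :=
    (continuousAt_dH_self hX).eventually_lt continuousAt_const (by rwa [dH_self hX])
  intro hcl
  obtain ⟨Y, hYε, hY⟩ := (mem_closure_iff_frequently.mp hcl).and_eventually hev |>.exists
  exact hYε.2 (h Y hYε.1 hY)

theorem subset_horoBallCl_suppFn {n : ℕ} {K : Set (Fin (n + 2) → ℝ)} (hK : K ⊆ Hyp n)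
    (hc : IsCompact K) {e : Fin (n + 1) → ℝ} (he : e ∈ sph n) :
    K ⊆ horoBallCl n e (suppFn n K e) := by
  intro X hX
  have hneg := lprod_dir_neg (hK hX) he
  refine ⟨hK hX, hneg, ?_⟩
  have hcont : ContinuousOn (fun X => Real.log (-(lprod n X (dir e)))) K :=
    (continuous_lprod_left n (dir e)).neg.continuousOn.log fun Z hZ =>
      (neg_pos.mpr (lprod_dir_neg (hK hZ) he)).ne'
  have hle : Real.log (-(lprod n X (dir e))) ≤ suppFn n K e :=
    le_csSup (hc.image_of_continuousOn hcont).bddAbove (mem_image_of_mem _ hX)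
  have := (Real.log_le_iff_le_exp (neg_pos.mpr hneg)).mp hle
  linarith

theorem suppFn_le {n : ℕ} {K : Set (Fin (n + 2) → ℝ)} (hne : K.Nonempty)
    {e : Fin (n + 1) → ℝ} {s : ℝ} (h : K ⊆ horoBallCl n e s) : suppFn n K e ≤ s := by
  refine csSup_le (hne.image _) ?_
  rintro _ ⟨X, hX, rfl⟩
  obtain ⟨-, h1, h2⟩ := h hX
  exact (Real.log_le_iff_le_exp (neg_pos.mpr h1)).mpr (by linarith)

theorem horoBallCl_mono {n : ℕ} {e : Fin (n + 1) → ℝ} {s t : ℝ} (h : s ≤ t) :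
    horoBallCl n e s ⊆ horoBallCl n e t := fun _ hX =>
  ⟨hX.1, hX.2.1, (neg_le_neg (Real.exp_le_exp.mpr h)).trans hX.2.2⟩

/-- The geodesic from a point of a closed set `K` to a point outside `K` leaves `K` for the
last time at a boundary point of `K`. -/
theorem exists_geod_mem_closure {n : ℕ} {K : Set (Fin (n + 2) → ℝ)} (hK : IsClosed K)
    {X Y : Fin (n + 2) → ℝ} (hX : X ∈ Hyp n) (hY : Y ∈ Hyp n) (hXK : X ∉ K) (hYK : Y ∈ K) :
    ∃ t ∈ Ico (0 : ℝ) 1, geod Y X t ∈ K ∩ closure (Hyp n \ K) := by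
  have hne : Y ≠ X := fun h => hXK (h ▸ hYK)
  have hcont := continuousOn_geod hX hY hne
  have hcpt : IsCompact (Icc (0 : ℝ) 1 ∩ geod Y X ⁻¹' K) :=
    isCompact_Icc.of_isClosed_subset (hcont.preimage_isClosed_of_isClosed isClosed_Icc hK)
      inter_subset_left
  obtain ⟨t, ⟨ht, htK⟩, hmax⟩ := hcpt.exists_isGreatest
    ⟨0, left_mem_Icc.mpr zero_le_one, by simpa only [mem_preimage, geod_zero] using hYK⟩
  have ht1 : t < 1 := by
    refine ht.2.lt_of_ne ?_
    rintro rfl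
    exact hXK (by simpa only [mem_preimage, geod_one] using htK)
  refine ⟨t, ⟨ht.1, ht1⟩, htK, ?_⟩
  have htend : Tendsto (geod Y X) (𝓝[Ioo t 1] t) (𝓝 (geod Y X t)) :=
    (hcont t ht).mono fun r hr => ⟨ht.1.trans hr.1.le, hr.2.le⟩
  have : (𝓝[Ioo t 1] t).NeBot := left_nhdsWithin_Ioo_neBot ht1
  refine mem_closure_of_tendsto htend ?_
  filter_upwards [self_mem_nhdsWithin] with r hr
  have hr01 : r ∈ Icc (0 : ℝ) 1 := ⟨ht.1.trans hr.1.le, hr.2.le⟩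
  exact ⟨geod_mem_Hyp hX hY hne hr01, fun hrK => hr.1.not_ge (hmax ⟨hr01, hrK⟩)⟩

/-- Every h-convex body is the intersection of all its supporting horo-balls:
`K = ∩_{e ∈ 𝕊^n} B̄_e(u(K,e))`. -/
theorem eq_iInter_horoBallCl (n : ℕ) (hn : 1 ≤ n)
    (K : Set (Fin (n + 2) → ℝ)) (hK : IsHConvexBody n K) :
    K = ⋂ e ∈ sph n, horoBallCl n e (suppFn n K e) := by
  obtain ⟨⟨hsub, hcl, hsupp⟩, hcpt, Y, hY⟩ := hK
  have hYK := relInt_subset n K hY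
  refine Subset.antisymm
    (subset_iInter₂ fun e he => subset_horoBallCl_suppFn hsub hcpt he) fun X hX => ?_
  rw [mem_iInter₂] at hX
  by_contra hXK
  have hXH : X ∈ Hyp n := by
    refine (hX (Pi.single 0 1) ?_).1
    simp [sph, Pi.single_apply]
  obtain ⟨t, ⟨ht0, ht1⟩, ht⟩ := exists_geod_mem_closure hcl hXH hY.1 hXK hYK
  have hne : Y ≠ X := fun h => hXK (h ▸ hYK)
  have ht0' : 0 < t := by
    refine ht0.lt_of_ne ?_
    rintro rfl
    rw [geod_zero] at ht
    exact notMem_closure_of_mem_relInt hY ht.2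
  obtain ⟨e, he, s, hKs, hZ⟩ := hsupp _ ht
  have hXs := horoBallCl_mono (suppFn_le ⟨Y, hYK⟩ hKs) (hX e he)
  exact (neg_exp_lt_lprod_geod hXs (hKs hYK) hne ht0' ht1).ne' hZ.2

end Horo
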